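/- Let (Ω,F,P) be a complete filtered probability space and let X = (X_t)_{t≥0} be an adapted supermartingale whose sample paths are right-continuous with left limits, such that X_0 = 0 almost surely and all jumps of X are nonnegative (for every ω and every t > 0, the left limit X_{t−}(ω) satisfies X_{t−}(ω) ≤ X_t(ω)). Let M⁻_t(ω) = inf_{0≤s≤t} min(X_s(ω), 0). Then for every 0 < p < 1 and every t ≥ 0, E[|X_t|^p] ≤ C_p^p · E[(−M⁻_t)^p], where C_p = (1−p)/p if p ≤ p₀, and C_p = (1 + α_p^{−1})^{1/p} if p > p₀; here p₀ ∈ (0,1) is the unique solution of 1/p₀ − 1 = (1/p₀ − 1)^{1−p₀} + 1, and for p > p₀, α_p is the unique positive solution of (1−p)·(α^{1/(1−p)} + 1) = α + 1. -/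

import Mathlib

open MeasureTheory Filter Set
open scoped NNReal

theorem one_add_rpow_le_rpow {p p₀ : ℝ} (hp : 0 < p) (hpp : p ≤ p₀) (h0 : p₀ < 1)
    (h : 1 / p₀ - 1 = (1 / p₀ - 1) ^ (1 - p₀) + 1) :
    1 + ((1 - p) / p) ^ (p - 1) ≤ ((1 - p) / p) ^ p := by
  have hp0 : 0 < p₀ := hp.trans_le hpp
  have hhalf : p₀ < 1 / 2 := by
    have h1 : 0 < 1 / p₀ - 1 := by
      have := one_lt_one_div hp0 h0
      linarith
    have h2 : 2 < 1 / p₀ := by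
      have := Real.rpow_pos_of_pos h1 (1 - p₀)
      linarith
    rw [lt_div_iff₀ hp0] at h2
    linarith
  have key : ∀ q : ℝ, 0 < q → q < 1 / 2 →
      Real.exp (Real.binEntropy q + Real.log (1 - 2 * q)) =
        ((1 - q) / q) ^ q - ((1 - q) / q) ^ (q - 1) := by
    intro q hq hq2
    have hb : 0 < (1 - q) / q := div_pos (by linarith) hq
    rw [Real.rpow_sub_one hb.ne', Real.exp_add, Real.exp_log (by linarith),
      Real.rpow_def_of_pos hb, Real.log_div (by linarith) hq.ne',
      Real.binEntropy_eq_negMulLog_add_negMulLog_one_sub]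
    have : Real.negMulLog q + Real.negMulLog (1 - q)
        = (Real.log (1 - q) - Real.log q) * q + (- Real.log (1 - q)) := by
      simp only [Real.negMulLog]; ring
    rw [this, Real.exp_add, Real.exp_neg, Real.exp_log (by linarith)]
    have : 1 - q ≠ 0 := by linarith
    field_simp
    ring
  have hconc : ConcaveOn ℝ (Ico 0 (1 / 2)) (fun q => Real.binEntropy q + Real.log (1 - 2 * q)) := by
    refine ConcaveOn.add ?_ ?_
    · refine Real.strictConcave_binEntropy.concaveOn.subset ?_ (convex_Ico _ _)
      intro x hx; exact ⟨hx.1, by linarith [hx.2]⟩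
    · refine ⟨convex_Ico _ _, ?_⟩
      intro x hx y hy a b ha hb hab
      have := strictConcaveOn_log_Ioi.concaveOn.2 (x := 1 - 2 * x) (y := 1 - 2 * y)
        (by simp; linarith [hx.2]) (by simp; linarith [hy.2]) ha hb hab
      simp only [smul_eq_mul] at this ⊢
      convert this using 2
      linear_combination (-1 : ℝ) * hab
  have hz : Real.binEntropy p₀ + Real.log (1 - 2 * p₀) = 0 := by
    have hb : 0 < (1 - p₀) / p₀ := div_pos (by linarith) hp0
    have e : 1 / p₀ - 1 = (1 - p₀) / p₀ := by field_simp
    rw [e] at h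
    have := key p₀ hp0 hhalf
    rw [← Real.exp_eq_one_iff, this]
    have h3 : ((1 - p₀) / p₀) ^ (1 - p₀) * ((1 - p₀) / p₀) ^ (p₀ - 1) = 1 := by
      rw [← Real.rpow_add hb]; simp
    have h4 : ((1 - p₀) / p₀) ^ p₀ = ((1 - p₀) / p₀) * ((1 - p₀) / p₀) ^ (p₀ - 1) := by
      rw [Real.rpow_sub_one hb.ne', mul_div_cancel₀ _ hb.ne']
    rw [h4]
    linear_combination ((1 - p₀) / p₀) ^ (p₀ - 1) * h + h3
  have hge : 0 ≤ Real.binEntropy p + Real.log (1 - 2 * p) := by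
    have ha : 0 ≤ 1 - p / p₀ := by rw [sub_nonneg, div_le_one hp0]; exact hpp
    have hb : 0 ≤ p / p₀ := by positivity
    have h00 : (0 : ℝ) ∈ Ico (0 : ℝ) (1 / 2) := by constructor <;> norm_num
    have := hconc.2 h00 ⟨hp0.le, hhalf⟩ ha hb (by ring)
    simp only [hz, smul_eq_mul, mul_zero, zero_add, div_mul_cancel₀ _ hp0.ne'] at this
    simpa using this
  have := key p hp (by linarith)
  have h1 := Real.one_le_exp hge
  rw [this] at h1
  linarith

theorem exists_tangent_point {p p₀ C : ℝ} (hp : 0 < p) (hp1 : p < 1)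
    (hp₀ : p₀ ∈ Set.Ioo (0 : ℝ) 1)
    (hp₀eq : 1 / p₀ - 1 = (1 / p₀ - 1) ^ (1 - p₀) + 1)
    (hC₁ : p ≤ p₀ → C = (1 - p) / p)
    (hC₂ : p₀ < p → ∃ α : ℝ, 0 < α ∧ (1 - p) * (α ^ (1 / (1 - p)) + 1) = α + 1 ∧
      C = (1 + α⁻¹) ^ (1 / p)) :
    ∃ β : ℝ, 0 < β ∧ 1 + β ^ (p - 1) ≤ C ^ p ∧ (1 - p) * (β ^ p + β ^ (p - 1)) ≤ C ^ p := by
  rcases le_or_gt p p₀ with h | h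
  · have hb : 0 < (1 - p) / p := div_pos (by linarith) hp
    refine ⟨(1 - p) / p, hb, ?_, ?_⟩
    · rw [hC₁ h]
      exact one_add_rpow_le_rpow hp h hp₀.2 hp₀eq
    · rw [hC₁ h, Real.rpow_sub_one hb.ne']
      apply le_of_eq
      have : 1 - p ≠ 0 := by linarith
      field_simp
      ring
  · obtain ⟨α, hα, he, hC⟩ := hC₂ h
    have hK : C ^ p = 1 + α⁻¹ := by
      rw [hC, ← Real.rpow_mul (by positivity), one_div_mul_cancel hp.ne', Real.rpow_one]
    have hb : 0 < α ^ (1 / (1 - p)) := by positivity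
    have hbi : (α ^ (1 / (1 - p))) ^ (p - 1) = α⁻¹ := by
      rw [← Real.rpow_mul hα.le, ← Real.rpow_neg_one]
      congr 1
      have : 1 - p ≠ 0 := by linarith
      field_simp
      ring
    have hbp : (α ^ (1 / (1 - p))) ^ p = α ^ (1 / (1 - p)) * α⁻¹ := by
      rw [← hbi, Real.rpow_sub_one hb.ne']; field_simp
    refine ⟨_, hb, by rw [hbi, hK], ?_⟩
    rw [hbp, hbi, hK]
    apply le_of_eq
    have : α * α⁻¹ = 1 := mul_inv_cancel₀ hα.ne'
    linear_combination α⁻¹ * he + this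

/-- Tangent line majorant of `x ↦ |x| ^ p` on `[-m, ∞)`. -/
theorem abs_rpow_le_linear {p β K m x : ℝ} (hp : 0 < p) (hp1 : p < 1) (hβ : 0 < β)
    (h₁ : 1 + β ^ (p - 1) ≤ K) (h₂ : (1 - p) * (β ^ p + β ^ (p - 1)) ≤ K)
    (hm : 0 < m) (hx : -m ≤ x) :
    |x| ^ p ≤ K * m ^ p + β ^ (p - 1) * (p * (m ^ (p - 1) * x) - (1 - p) * m ^ p) := by
  have hmp : m ^ p = m ^ (p - 1) * m := by rw [Real.rpow_sub_one hm.ne']; field_simp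
  have hbp : β ^ p = β ^ (p - 1) * β := by rw [Real.rpow_sub_one hβ.ne']; field_simp
  have hm1 : 0 < m ^ (p - 1) := by positivity
  have hb1 : 0 < β ^ (p - 1) := by positivity
  have hmp0 : 0 < m ^ p := by positivity
  rcases le_or_gt 0 x with h0 | h0
  · rw [abs_of_nonneg h0]
    have hz : 0 < β * m := by positivity
    have am := Real.geom_mean_le_arith_mean2_weighted hp.le (by linarith : 0 ≤ 1 - p) h0 hz.le
      (by ring)
    have hzz : (β * m) ^ (1 - p) * (β ^ (p - 1) * m ^ (p - 1)) = 1 := by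
      rw [← Real.mul_rpow hβ.le hm.le, ← Real.rpow_add hz]; simp
    have := mul_le_mul_of_nonneg_right am (mul_pos hb1 hm1).le
    rw [mul_assoc, hzz, mul_one] at this
    have h3 := mul_le_mul_of_nonneg_right h₂ hmp0.le
    refine this.trans ?_
    have : (p * x + (1 - p) * (β * m)) * (β ^ (p - 1) * m ^ (p - 1))
      = p * x * β ^ (p - 1) * m ^ (p - 1) + (1 - p) * β ^ p * m ^ p := by rw [hbp, hmp]; ring
    rw [this]
    nlinarith
  · have : |x| ^ p ≤ m ^ p := Real.rpow_le_rpow (abs_nonneg _) (abs_le.2 ⟨hx, by linarith⟩) hp.le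
    have h3 := mul_le_mul_of_nonneg_right h₁ hmp0.le
    have h4 : -m ^ p ≤ m ^ (p - 1) * x := by rw [hmp]; nlinarith
    have h5 := mul_le_mul_of_nonneg_left h4 (mul_pos hb1 hp).le
    nlinarith

theorem rpow_sub_mul_le {p a b : ℝ} (hp : 0 < p) (hp1 : p < 1) (ha : 0 < a) (hab : 0 < b) :
    p * ((a ^ (p - 1) - b ^ (p - 1)) * a) ≤ (1 - p) * (b ^ p - a ^ p) := by
  have hb1 : 0 < b ^ (p - 1) := by positivity
  have hap : a ^ p = a ^ (p - 1) * a := by rw [Real.rpow_sub_one ha.ne']; field_simp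
  have hbp : b ^ p = b ^ (p - 1) * b := by rw [Real.rpow_sub_one hab.ne']; field_simp
  have am := Real.geom_mean_le_arith_mean2_weighted hp.le (by linarith : 0 ≤ 1 - p) ha.le hab.le
      (by ring)
  have : b ^ (1 - p) * b ^ (p - 1) = 1 := by rw [← Real.rpow_add hab]; simp
  have h2 := mul_le_mul_of_nonneg_right am hb1.le
  rw [mul_assoc, this, mul_one] at h2
  rw [hbp]
  nlinarith

theorem le_rpow_sub_mul {p a b : ℝ} (hp : 0 < p) (hp1 : p < 1) (ha : 0 < a) (hab : 0 < b) :
    (1 - p) * (b ^ p - a ^ p) ≤ p * ((a ^ (p - 1) - b ^ (p - 1)) * b) := by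
  have := rpow_sub_mul_le hp hp1 hab ha
  linarith

/-- Running maximum of `0, y 1, …, y n`. -/
def runMax (y : ℕ → ℝ) : ℕ → ℝ
  | 0 => 0
  | k + 1 => max (runMax y k) (y (k + 1))

theorem runMax_le_succ (y : ℕ → ℝ) (k : ℕ) : runMax y k ≤ runMax y (k + 1) := le_max_left _ _

theorem runMax_mono (y : ℕ → ℝ) : Monotone (runMax y) := monotone_nat_of_le_succ (runMax_le_succ y)

theorem runMax_nonneg (y : ℕ → ℝ) (k : ℕ) : 0 ≤ runMax y k := runMax_mono y (Nat.zero_le k)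

theorem le_runMax {y : ℕ → ℝ} (h0 : y 0 = 0) (k : ℕ) : y k ≤ runMax y k := by
  cases k with
  | zero => exact h0.le
  | succ k => exact le_max_right _ _

theorem runMax_le {y : ℕ → ℝ} {n : ℕ} {B : ℝ} (hB : 0 ≤ B) (h : ∀ k ≤ n, y k ≤ B) :
    runMax y n ≤ B := by
  induction n with
  | zero => exact hB
  | succ n ih => exact max_le (ih fun k hk => h k (by omega)) (h _ le_rfl)

theorem mul_eq_sum_add_sum (A Y : ℕ → ℝ) (n : ℕ) :
    A n * Y n = A 0 * Y 0 + ∑ k ∈ Finset.range n, A k * (Y (k + 1) - Y k)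
      - ∑ k ∈ Finset.range n, (A k - A (k + 1)) * Y (k + 1) := by
  induction n with
  | zero => simp
  | succ n ih =>
    rw [Finset.sum_range_succ, Finset.sum_range_succ]
    linear_combination ih

theorem rpow_runMax_antitone {p ε : ℝ} (hp1 : p < 1) (hε : 0 < ε) (y : ℕ → ℝ) :
    Antitone fun k => (runMax y k + ε) ^ (p - 1) := fun i j hij =>
  Real.rpow_le_rpow_of_nonpos (by have := runMax_nonneg y i; positivity)
    (by have := runMax_mono y hij; linarith) (by linarith)

/-- Discretization error: it is small when the increments of the running maximum are small. -/
noncomputable def gapSum (p ε L : ℝ) (y : ℕ → ℝ) (n : ℕ) : ℝ :=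
  ∑ k ∈ Finset.range n, ((runMax y k + ε) ^ (p - 1) - (runMax y (k + 1) + ε) ^ (p - 1)) *
    min (runMax y (k + 1) - runMax y k) L

theorem gapSum_nonneg {p ε L : ℝ} (hp1 : p < 1) (hε : 0 < ε) (hL : 0 ≤ L) (y : ℕ → ℝ) (n : ℕ) :
    0 ≤ gapSum p ε L y n :=
  Finset.sum_nonneg fun k _ => mul_nonneg
    (sub_nonneg.2 (rpow_runMax_antitone hp1 hε y (Nat.le_succ k)))
    (le_min (sub_nonneg.2 (runMax_le_succ y k)) hL)

theorem gapSum_le {p ε L η : ℝ} (hp1 : p < 1) (hε : 0 < ε) (hη : 0 ≤ η) (y : ℕ → ℝ) (n : ℕ)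
    (h : ∀ k < n, min (runMax y (k + 1) - runMax y k) L ≤ η) :
    gapSum p ε L y n ≤ ε ^ (p - 1) * η := by
  have h1 : gapSum p ε L y n ≤ ∑ k ∈ Finset.range n,
      ((runMax y k + ε) ^ (p - 1) - (runMax y (k + 1) + ε) ^ (p - 1)) * η :=
    Finset.sum_le_sum fun k hk => mul_le_mul_of_nonneg_left (h k (Finset.mem_range.1 hk))
      (sub_nonneg.2 (rpow_runMax_antitone hp1 hε y (Nat.le_succ k)))
  refine h1.trans ?_
  rw [← Finset.sum_mul, Finset.sum_range_sub' (fun k => (runMax y k + ε) ^ (p - 1))]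
  refine mul_le_mul_of_nonneg_right ?_ hη
  have : 0 ≤ (runMax y n + ε) ^ (p - 1) := by have := runMax_nonneg y n; positivity
  simp only [runMax, zero_add]
  linarith

theorem neg_rpow_mul_le {p ε L : ℝ} (hp : 0 < p) (hp1 : p < 1) (hε : 0 < ε)
    {y : ℕ → ℝ} (h0 : y 0 = 0) (n : ℕ) :
    p * ((runMax y n + ε) ^ (p - 1) * -y n) ≤
      (1 - p) * (runMax y n + ε) ^ p + p * (gapSum p ε L y n + ε ^ (p - 1) * max (y n - L) 0)
      - p * (∑ k ∈ Finset.range n, (runMax y k + ε) ^ (p - 1) * (y (k + 1) - y k)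
        + ∑ k ∈ Finset.range n, (ε ^ (p - 1) - (runMax y k + ε) ^ (p - 1)) *
          (max (y (k + 1) - L) 0 - max (y k - L) 0)) := by
  have hpos : ∀ k, 0 < runMax y k + ε := fun k => by have := runMax_nonneg y k; positivity
  have e1 := mul_eq_sum_add_sum (fun k => (runMax y k + ε) ^ (p - 1)) y n
  have e2 := mul_eq_sum_add_sum (fun k => ε ^ (p - 1) - (runMax y k + ε) ^ (p - 1))
    (fun k => max (y k - L) 0) n
  have hs : ∑ k ∈ Finset.range n,
      p * (((runMax y k + ε) ^ (p - 1) - (runMax y (k + 1) + ε) ^ (p - 1)) * y (k + 1)) ≤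
    ∑ k ∈ Finset.range n, ((1 - p) * ((runMax y (k + 1) + ε) ^ p - (runMax y k + ε) ^ p) +
      p * (((runMax y k + ε) ^ (p - 1) - (runMax y (k + 1) + ε) ^ (p - 1)) *
        min (runMax y (k + 1) - runMax y k) L) +
      p * (((runMax y k + ε) ^ (p - 1) - (runMax y (k + 1) + ε) ^ (p - 1)) *
        max (y (k + 1) - L) 0)) := by
    refine Finset.sum_le_sum fun k _ => ?_
    have hg : 0 ≤ (runMax y k + ε) ^ (p - 1) - (runMax y (k + 1) + ε) ^ (p - 1) :=
      sub_nonneg.2 (rpow_runMax_antitone hp1 hε y (Nat.le_succ k))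
    have h1 := rpow_sub_mul_le hp hp1 (hpos k) (hpos (k + 1))
    have hm := runMax_nonneg y k
    have hy : y (k + 1) ≤ (runMax y k + ε) + min (runMax y (k + 1) - runMax y k) L
        + max (y (k + 1) - L) 0 := by
      have := le_runMax h0 (k + 1)
      rcases min_choice (runMax y (k + 1) - runMax y k) L with h | h <;> rw [h]
      · have := le_max_right (y (k + 1) - L) 0
        linarith
      · have := le_max_left (y (k + 1) - L) 0
        linarith
    have h2 := mul_le_mul_of_nonneg_left hy (mul_nonneg hp.le hg)
    nlinarith
  simp only [Finset.sum_add_distrib, ← Finset.mul_sum] at hs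
  rw [Finset.sum_range_sub (fun k => (runMax y k + ε) ^ p)] at hs
  change _ ≤ _ + p * gapSum p ε L y n + _ at hs
  simp only [sub_sub_sub_cancel_left, h0, mul_zero, zero_add] at e1 e2
  have e3 : ε ^ (p - 1) - (runMax y 0 + ε) ^ (p - 1) = 0 := by simp [runMax]
  rw [e3, zero_mul, zero_add] at e2
  have e4 : ∀ (a b c : ℕ → ℝ), ∑ k ∈ Finset.range n, (a k - b k) * c k =
      - ∑ k ∈ Finset.range n, (b k - a k) * c k := by
    intro a b c
    rw [← Finset.sum_neg_distrib]
    exact Finset.sum_congr rfl fun _ _ => by ring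
  rw [e4 (fun k => (runMax y (k + 1) + ε) ^ (p - 1)) (fun k => (runMax y k + ε) ^ (p - 1))
    (fun k => max (y (k + 1) - L) 0)] at e2
  have h5 : 0 ≤ (runMax y n + ε) ^ (p - 1) * max (y n - L) 0 :=
    mul_nonneg (Real.rpow_nonneg (hpos n).le _) (le_max_right _ _)
  have h6 : 0 ≤ (1 - p) * (runMax y 0 + ε) ^ p :=
    mul_nonneg (by linarith) (Real.rpow_nonneg (hpos 0).le _)
  have h7 := mul_nonneg hp.le h5
  linear_combination hs + h6 + h7 - p * e1 - p * e2

theorem rpow_runMax_le {p : ℝ} (hp : 0 < p) (hp1 : p < 1) (y : ℕ → ℝ) (n : ℕ) :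
    (1 - p) * (runMax y n + 1) ^ p ≤ 1 + p * |y n|
      - p * ∑ k ∈ Finset.range n, (1 - (runMax y k + 1) ^ (p - 1)) * (y (k + 1) - y k) := by
  have hpos : ∀ k, 0 < runMax y k + 1 := fun k => by have := runMax_nonneg y k; positivity
  have e1 := mul_eq_sum_add_sum (fun k => 1 - (runMax y k + 1) ^ (p - 1)) y n
  have hs : ∑ k ∈ Finset.range n, (1 - p) * ((runMax y (k + 1) + 1) ^ p - (runMax y k + 1) ^ p) ≤
      ∑ k ∈ Finset.range n,
      (p * (((1 - (runMax y (k + 1) + 1) ^ (p - 1)) - (1 - (runMax y k + 1) ^ (p - 1))) * y (k + 1))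
      + p * ((runMax y k + 1) ^ (p - 1) - (runMax y (k + 1) + 1) ^ (p - 1))) := by
    refine Finset.sum_le_sum fun k _ => ?_
    have h1 := le_rpow_sub_mul hp hp1 (hpos k) (hpos (k + 1))
    have hm : runMax y (k + 1) = max (runMax y k) (y (k + 1)) := rfl
    rcases max_choice (runMax y k) (y (k + 1)) with h | h <;> rw [h] at hm
    · rw [hm] at h1 ⊢; simp
    · rw [hm] at h1 ⊢; linarith
  simp only [Finset.sum_add_distrib, ← Finset.mul_sum] at hs
  rw [Finset.sum_range_sub (fun k => (runMax y k + 1) ^ p),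
    Finset.sum_range_sub' (fun k => (runMax y k + 1) ^ (p - 1))] at hs
  have e4 : ∀ (a b c : ℕ → ℝ), ∑ k ∈ Finset.range n, (a k - b k) * c k =
      - ∑ k ∈ Finset.range n, (b k - a k) * c k := by
    intro a b c
    rw [← Finset.sum_neg_distrib]
    exact Finset.sum_congr rfl fun _ _ => by ring
  rw [e4 (fun k => 1 - (runMax y (k + 1) + 1) ^ (p - 1)) (fun k => 1 - (runMax y k + 1) ^ (p - 1))
    (fun k => y (k + 1))] at hs
  have e0 : runMax y 0 = 0 := rfl
  simp only [e0, zero_add, Real.one_rpow, sub_self, zero_mul] at e1 hs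
  have hg0 : 0 ≤ (runMax y n + 1) ^ (p - 1) := Real.rpow_nonneg (hpos n).le _
  have hg1 : (runMax y n + 1) ^ (p - 1) ≤ 1 := by
    simpa [e0] using rpow_runMax_antitone hp1 one_pos y (Nat.zero_le n)
  have h8 : (1 - (runMax y n + 1) ^ (p - 1)) * y n ≤ |y n| := by
    have h9 := le_abs_self (y n)
    have h10 := abs_nonneg (y n)
    nlinarith
  have h11 := mul_le_mul_of_nonneg_left h8 hp.le
  have h12 := mul_nonneg hp.le hg0
  linear_combination hs + h11 + h12 - p * e1

theorem exists_sub_le_of_rightCts {x : ℝ≥0 → ℝ}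
    (hrc : ∀ t : ℝ≥0, ContinuousWithinAt x (Ici t) t)
    (hll : ∀ t : ℝ≥0, 0 < t → ∃ l : ℝ, Tendsto x (nhdsWithin t (Iio t)) (nhds l))
    (hjump : ∀ t : ℝ≥0, 0 < t → ∀ l : ℝ, Tendsto x (nhdsWithin t (Iio t)) (nhds l) → l ≤ x t)
    (t : ℝ≥0) {η : ℝ} (hη : 0 < η) :
    ∃ δ > 0, ∀ u ≤ t, ∀ v, u ≤ v → dist v u < δ → x u - x v ≤ η := by
  have hloc : ∀ τ : ℝ≥0, ∃ U : Set ℝ≥0, IsOpen U ∧ τ ∈ U ∧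
      ∀ u ∈ U, ∀ v ∈ U, u ≤ v → x u - x v ≤ η := by
    intro τ
    have hr : ∀ᶠ u in nhds τ, τ ≤ u → |x u - x τ| < η / 2 := by
      have := (hrc τ).eventually (Metric.ball_mem_nhds _ (half_pos hη))
      rw [eventually_nhdsWithin_iff] at this
      filter_upwards [this] with u hu h
      simpa [Real.dist_eq] using hu h
    have hl : ∃ l ≤ x τ, ∀ᶠ u in nhds τ, u < τ → |x u - l| < η / 2 := by
      rcases (zero_le : 0 ≤ τ).eq_or_lt with h | h
      · refine ⟨x τ, le_rfl, Eventually.of_forall fun u hu => ?_⟩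
        rw [← h] at hu
        exact absurd hu not_lt_zero
      · obtain ⟨l, hl⟩ := hll τ h
        refine ⟨l, hjump τ h l hl, ?_⟩
        have := hl.eventually (Metric.ball_mem_nhds _ (half_pos hη))
        rw [eventually_nhdsWithin_iff] at this
        filter_upwards [this] with u hu h
        simpa [Real.dist_eq] using hu h
    obtain ⟨l, hlx, hl⟩ := hl
    obtain ⟨U, hU, hUo, hτ⟩ := eventually_nhds_iff.1 (hr.and hl)
    refine ⟨U, hUo, hτ, fun u hu v hv huv => ?_⟩
    rcases le_or_gt τ u with h1 | h1
    · have a := abs_lt.1 ((hU u hu).1 h1)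
      have b := abs_lt.1 ((hU v hv).1 (h1.trans huv))
      linarith
    · have a := abs_lt.1 ((hU u hu).2 h1)
      rcases le_or_gt τ v with h2 | h2
      · have b := abs_lt.1 ((hU v hv).1 h2)
        linarith
      · have b := abs_lt.1 ((hU v hv).2 h2)
        linarith
  choose U hUo hmem hU using hloc
  obtain ⟨δ, hδ, h⟩ := lebesgue_number_lemma_of_metric (isCompact_Icc (a := (0 : ℝ≥0)) (b := t))
    hUo (fun τ _ => mem_iUnion.2 ⟨τ, hmem τ⟩)
  refine ⟨δ, hδ, fun u hu v huv hd => ?_⟩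
  obtain ⟨i, hi⟩ := h u ⟨zero_le, hu⟩
  exact hU i u (hi (Metric.mem_ball_self hδ)) v (hi hd) huv

/-- The `k`-th point of the uniform grid on `[0, t]` with `n + 1` steps. -/
noncomputable def grid (t : ℝ≥0) (n k : ℕ) : ℝ≥0 := k * (t / (n + 1 : ℕ))

theorem grid_zero (t : ℝ≥0) (n : ℕ) : grid t n 0 = 0 := by simp [grid]

theorem grid_last (t : ℝ≥0) (n : ℕ) : grid t n (n + 1) = t := by
  rw [grid, mul_div_cancel₀]
  exact Nat.cast_ne_zero.2 (Nat.succ_ne_zero n)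

theorem grid_mono (t : ℝ≥0) (n : ℕ) : Monotone (grid t n) := fun _ _ h =>
  mul_le_mul_of_nonneg_right (Nat.cast_le.2 h) zero_le

theorem grid_succ (t : ℝ≥0) (n k : ℕ) : grid t n (k + 1) = grid t n k + t / (n + 1 : ℕ) := by
  simp only [grid]; push_cast; ring

theorem exists_grid_le (t : ℝ≥0) (n : ℕ) {s : ℝ≥0} (hs : s ≤ t) :
    ∃ k ≤ n + 1, grid t n k ≤ s ∧ s ≤ grid t n k + t / (n + 1 : ℕ) := by
  have key : ∀ N : ℕ, ∀ s ≤ grid t n N, ∃ k ≤ N, grid t n k ≤ s ∧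
      s ≤ grid t n k + t / (n + 1 : ℕ) := by
    intro N
    induction N with
    | zero =>
      intro s hs
      exact ⟨0, le_rfl, by simp [grid], hs.trans (by simp)⟩
    | succ N ih =>
      intro s hs
      rcases le_total s (grid t n N) with h | h
      · obtain ⟨k, hk, h1⟩ := ih s h
        exact ⟨k, hk.trans (Nat.le_succ N), h1⟩
      · exact ⟨N, Nat.le_succ N, h, by rwa [← grid_succ]⟩
  exact key (n + 1) s (by rwa [grid_last])

theorem eventually_grid_approx {x : ℝ≥0 → ℝ} (h0 : x 0 = 0)
    (hrc : ∀ t : ℝ≥0, ContinuousWithinAt x (Ici t) t)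
    (hll : ∀ t : ℝ≥0, 0 < t → ∃ l : ℝ, Tendsto x (nhdsWithin t (Iio t)) (nhds l))
    (hjump : ∀ t : ℝ≥0, 0 < t → ∀ l : ℝ, Tendsto x (nhdsWithin t (Iio t)) (nhds l) → l ≤ x t)
    (t : ℝ≥0) {η : ℝ} (hη : 0 < η) :
    ∀ᶠ n : ℕ in atTop,
      (∀ k < n + 1, runMax (fun k => -x (grid t n k)) (k + 1)
        - runMax (fun k => -x (grid t n k)) k ≤ η) ∧
      ∀ s ≤ t, -x s ≤ runMax (fun k => -x (grid t n k)) (n + 1) + η := by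
  obtain ⟨δ, hδ, h⟩ := exists_sub_le_of_rightCts hrc hll hjump t hη
  have hlim : Tendsto (fun n : ℕ => (t : ℝ) / ((n + 1 : ℕ) : ℝ)) atTop (nhds 0) :=
    (tendsto_const_div_atTop_nhds_zero_nat (t : ℝ)).comp (tendsto_add_atTop_nat 1)
  filter_upwards [hlim.eventually (gt_mem_nhds hδ)] with n hn
  have hz : (fun k => -x (grid t n k)) 0 = 0 := by simp [grid_zero, h0]
  have hd : ∀ u v : ℝ≥0, u ≤ v → v ≤ u + t / (n + 1 : ℕ) → dist v u < δ := by
    intro u v huv hv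
    rw [NNReal.dist_eq, abs_of_nonneg (sub_nonneg.2 (NNReal.coe_le_coe.2 huv))]
    have := NNReal.coe_le_coe.2 hv
    push_cast at this hn
    linarith
  have hlast : ∀ k ≤ n + 1, grid t n k ≤ t := fun k hk => by
    simpa only [grid_last] using grid_mono t n hk
  refine ⟨fun k hk => ?_, fun s hs => ?_⟩
  · have h1 := h (grid t n k) (hlast k hk.le) (grid t n (k + 1)) (grid_mono t n (Nat.le_succ k))
      (hd _ _ (grid_mono t n (Nat.le_succ k)) (grid_succ t n k).le)
    have h2 := le_runMax (y := fun k => -x (grid t n k)) hz k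
    rw [sub_le_iff_le_add']
    refine max_le (by linarith) ?_
    linarith
  · obtain ⟨k, hk, h1, h2⟩ := exists_grid_le t n hs
    have h3 := h (grid t n k) (hlast k hk) s h1 (hd _ _ h1 h2)
    have h4 := (le_runMax (y := fun k => -x (grid t n k)) hz k).trans (runMax_mono _ hk)
    linarith

/-- The running infimum `M⁻_t`, with its sign changed, as in the main statement. -/
noncomputable def negRunInf (x : ℝ≥0 → ℝ) (t : ℝ≥0) : ℝ :=
  -(⨅ s : Icc (0 : ℝ≥0) t, min (x s.1) 0)

theorem negRunInf_le {x : ℝ≥0 → ℝ} {t : ℝ≥0} {B : ℝ} (hB : 0 ≤ B) (h : ∀ s ≤ t, -x s ≤ B) :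
    negRunInf x t ≤ B := by
  have : Nonempty (Icc (0 : ℝ≥0) t) := ⟨⟨0, le_rfl, zero_le⟩⟩
  rw [negRunInf, neg_le]
  exact le_ciInf fun s => le_min (by linarith [h s.1 s.2.2]) (by linarith)

theorem runMax_le_negRunInf {x : ℝ≥0 → ℝ} {t : ℝ≥0} {B : ℝ} (h : ∀ s ≤ t, -x s ≤ B) (n : ℕ) :
    runMax (fun k => -x (grid t n k)) (n + 1) ≤ negRunInf x t := by
  have hbdd : BddBelow (range fun s : Icc (0 : ℝ≥0) t => min (x s.1) 0) := by
    refine ⟨min (-B) 0, ?_⟩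
    rintro _ ⟨s, rfl⟩
    exact min_le_min_right _ (by linarith [h s.1 s.2.2])
  have hle : ∀ s ≤ t, ⨅ s : Icc (0 : ℝ≥0) t, min (x s.1) 0 ≤ min (x s) 0 := fun s hs =>
    ciInf_le hbdd ⟨s, zero_le, hs⟩
  refine runMax_le ?_ fun k hk => ?_
  · have := (hle 0 zero_le).trans (min_le_right _ _)
    rw [negRunInf]; linarith
  · have := (hle (grid t n k) (by simpa only [grid_last] using grid_mono t n hk)).trans
      (min_le_left _ _)
    rw [negRunInf]; linarith

theorem tendsto_runMax_negRunInf {x : ℝ≥0 → ℝ} (h0 : x 0 = 0)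
    (hrc : ∀ t : ℝ≥0, ContinuousWithinAt x (Ici t) t)
    (hll : ∀ t : ℝ≥0, 0 < t → ∃ l : ℝ, Tendsto x (nhdsWithin t (Iio t)) (nhds l))
    (hjump : ∀ t : ℝ≥0, 0 < t → ∀ l : ℝ, Tendsto x (nhdsWithin t (Iio t)) (nhds l) → l ≤ x t)
    (t : ℝ≥0) :
    (∀ n, runMax (fun k => -x (grid t n k)) (n + 1) ≤ negRunInf x t) ∧
    Tendsto (fun n => runMax (fun k => -x (grid t n k)) (n + 1)) atTop
      (nhds (negRunInf x t)) := by
  have hle : ∀ n, runMax (fun k => -x (grid t n k)) (n + 1) ≤ negRunInf x t := by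
    obtain ⟨n, -, hn⟩ := (eventually_grid_approx h0 hrc hll hjump t one_pos).exists
    exact runMax_le_negRunInf hn
  refine ⟨hle, Metric.tendsto_nhds.2 fun η hη => ?_⟩
  filter_upwards [eventually_grid_approx h0 hrc hll hjump t (half_pos hη)] with n hn
  have h1 := negRunInf_le (add_nonneg (runMax_nonneg _ _) (half_pos hη).le) hn.2
  rw [Real.dist_eq, abs_lt]
  constructor <;> linarith [hle n]

theorem tendsto_gapSum {x : ℝ≥0 → ℝ} (h0 : x 0 = 0)
    (hrc : ∀ t : ℝ≥0, ContinuousWithinAt x (Ici t) t)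
    (hll : ∀ t : ℝ≥0, 0 < t → ∃ l : ℝ, Tendsto x (nhdsWithin t (Iio t)) (nhds l))
    (hjump : ∀ t : ℝ≥0, 0 < t → ∀ l : ℝ, Tendsto x (nhdsWithin t (Iio t)) (nhds l) → l ≤ x t)
    (t : ℝ≥0) {p ε L : ℝ} (hp1 : p < 1) (hε : 0 < ε) (hL : 0 ≤ L) :
    Tendsto (fun n => gapSum p ε L (fun k => -x (grid t n k)) (n + 1)) atTop (nhds 0) := by
  have hg : 0 < ε ^ (p - 1) := by positivity
  refine Metric.tendsto_nhds.2 fun η hη => ?_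
  have hη' : 0 < η / 2 / ε ^ (p - 1) := by positivity
  filter_upwards [eventually_grid_approx h0 hrc hll hjump t hη'] with n hn
  have h1 := gapSum_le (L := L) hp1 hε hη'.le (fun k => -x (grid t n k)) (n + 1)
    fun k hk => (min_le_left _ _).trans (hn.1 k hk)
  rw [mul_div_cancel₀ _ hg.ne'] at h1
  rw [Real.dist_eq, sub_zero, abs_of_nonneg (gapSum_nonneg hp1 hε hL _ _)]
  linarith

section Discrete

variable {Ω : Type*} {m0 : MeasurableSpace Ω} {P : Measure Ω} {𝒢 : Filtration ℕ m0}
  {y : ℕ → Ω → ℝ}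

theorem stronglyAdapted_runMax (hy : StronglyAdapted 𝒢 y) :
    StronglyAdapted 𝒢 fun n ω => runMax (fun k => y k ω) n := by
  intro n
  induction n with
  | zero => exact stronglyMeasurable_const
  | succ n ih =>
    have h := ih.mono (𝒢.mono (Nat.le_succ n))
    exact @StronglyMeasurable.sup _ _ _ _ (𝒢 (n + 1)) _ _ _ h (hy (n + 1))

theorem integrable_runMax [IsFiniteMeasure P] (hy : ∀ n, Integrable (y n) P) (n : ℕ) :
    Integrable (fun ω => runMax (fun k => y k ω) n) P := by
  induction n with
  | zero => exact integrable_const _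
  | succ n ih => exact ih.sup (hy (n + 1))

theorem integral_sum_mul_sub_nonneg [IsFiniteMeasure P] {ξ f : ℕ → Ω → ℝ} {R : ℝ}
    (hf : Submartingale f 𝒢 P) (hξ : StronglyAdapted 𝒢 ξ) (hbdd : ∀ n ω, ξ n ω ≤ R)
    (hnonneg : ∀ n ω, 0 ≤ ξ n ω) (n : ℕ) :
    Integrable (fun ω => ∑ k ∈ Finset.range n, ξ k ω * (f (k + 1) ω - f k ω)) P ∧
      0 ≤ ∫ ω, ∑ k ∈ Finset.range n, ξ k ω * (f (k + 1) ω - f k ω) ∂P := by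
  have hS := hf.sum_mul_sub hξ hbdd hnonneg
  have hi := hS.integrable n
  have h := hS.setIntegral_le (Nat.zero_le n) MeasurableSet.univ
  have e : (∑ k ∈ Finset.range n, ξ k * (f (k + 1) - f k)) =
      fun ω => ∑ k ∈ Finset.range n, ξ k ω * (f (k + 1) ω - f k ω) := by
    ext ω; simp
  simp only [e] at hi h
  simp only [Finset.range_zero, Finset.sum_empty, Measure.restrict_univ, Pi.zero_apply,
    integral_zero] at h
  exact ⟨hi, h⟩

theorem integrable_rpow_runMax [IsFiniteMeasure P] (hy : ∀ n, Integrable (y n) P) {p ε : ℝ}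
    (hp : 0 < p) (hp1 : p < 1) (hε : 0 < ε) (n : ℕ) :
    Integrable (fun ω => (runMax (fun k => y k ω) n + ε) ^ p) P := by
  have h := integrable_runMax hy n
  refine ((h.add (integrable_const ε)).add (integrable_const 1)).mono'
    ((h.add (integrable_const ε)).aemeasurable.pow_const p).aestronglyMeasurable
    (ae_of_all _ fun ω => ?_)
  have h0 : 0 ≤ runMax (fun k => y k ω) n + ε := by
    have := runMax_nonneg (fun k => y k ω) n; positivity
  rw [Real.norm_eq_abs, abs_of_nonneg (Real.rpow_nonneg h0 _)]
  have := Real.geom_mean_le_arith_mean2_weighted hp.le (by linarith : 0 ≤ 1 - p) h0 zero_le_one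
    (by ring)
  simp only [Real.one_rpow, mul_one, Pi.add_apply] at this ⊢
  nlinarith

theorem aestronglyMeasurable_gapSum (hy : StronglyAdapted 𝒢 y) (p ε L : ℝ) (n : ℕ) :
    AEStronglyMeasurable (fun ω => gapSum p ε L (fun k => y k ω) n) P := by
  have hm : ∀ k, Measurable fun ω => runMax (fun k => y k ω) k := fun k =>
    ((stronglyAdapted_runMax hy k).mono (𝒢.le k)).measurable
  refine Measurable.aestronglyMeasurable (Finset.measurable_fun_sum _ fun k _ => ?_)
  exact ((((hm k).add_const ε).pow_const _).sub (((hm (k + 1)).add_const ε).pow_const _)).mul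
    (((hm (k + 1)).sub (hm k)).min measurable_const)

theorem gapSum_le_const {p ε L : ℝ} (hp1 : p < 1) (hε : 0 < ε) (hL : 0 ≤ L) (y : ℕ → ℝ) (n : ℕ) :
    gapSum p ε L y n ≤ ε ^ (p - 1) * L :=
  gapSum_le hp1 hε hL y n fun _ _ => min_le_right _ _

theorem integral_abs_rpow_le_discrete [IsFiniteMeasure P] (hy : Submartingale y 𝒢 P)
    (h0 : ∀ᵐ ω ∂P, y 0 ω = 0) {p β K ε L : ℝ} (hp : 0 < p) (hp1 : p < 1) (hβ : 0 < β)
    (h₁ : 1 + β ^ (p - 1) ≤ K) (h₂ : (1 - p) * (β ^ p + β ^ (p - 1)) ≤ K)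
    (hε : 0 < ε) (hL : 0 ≤ L) (n : ℕ) :
    ∫ ω, |y n ω| ^ p ∂P ≤ K * ∫ ω, (runMax (fun k => y k ω) n + ε) ^ p ∂P +
      β ^ (p - 1) * p * (∫ ω, gapSum p ε L (fun k => y k ω) n ∂P +
        ε ^ (p - 1) * ∫ ω, max (y n ω - L) 0 ∂P) := by
  have hε1 : 0 < ε ^ (p - 1) := by positivity
  have hβ1 : 0 < β ^ (p - 1) := by positivity
  have hM := stronglyAdapted_runMax hy.stronglyAdapted
  have hM0 : ∀ n ω, 0 ≤ runMax (fun k => y k ω) n := fun n ω => runMax_nonneg _ n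
  have hg : StronglyAdapted 𝒢 fun n ω => (runMax (fun k => y k ω) n + ε) ^ (p - 1) := fun n =>
    (((hM n).measurable.add_const ε).pow_const (p - 1)).stronglyMeasurable
  have hg0 : ∀ n ω, 0 ≤ (runMax (fun k => y k ω) n + ε) ^ (p - 1) := fun n ω =>
    Real.rpow_nonneg (add_nonneg (hM0 n ω) hε.le) _
  have hg1 : ∀ n ω, (runMax (fun k => y k ω) n + ε) ^ (p - 1) ≤ ε ^ (p - 1) := fun n ω => by
    simpa [runMax] using rpow_runMax_antitone hp1 hε (fun k => y k ω) (Nat.zero_le n)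
  have hY : Submartingale (fun k ω => max (y k ω - L) 0) 𝒢 P := by
    have := (hy.sub_martingale (martingale_const 𝒢 P L)).pos
    exact this
  obtain ⟨i1, n1⟩ := integral_sum_mul_sub_nonneg hy hg hg1 hg0 n
  obtain ⟨i2, n2⟩ := integral_sum_mul_sub_nonneg (R := ε ^ (p - 1))
    (ξ := fun n ω => ε ^ (p - 1) - (runMax (fun k => y k ω) n + ε) ^ (p - 1)) hY
    (fun n => stronglyMeasurable_const.sub (hg n)) (fun n ω => sub_le_self _ (hg0 n ω))
    (fun n ω => sub_nonneg.2 (hg1 n ω)) n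
  have iD : Integrable (fun ω => gapSum p ε L (fun k => y k ω) n) P := by
    refine Integrable.of_bound (aestronglyMeasurable_gapSum hy.stronglyAdapted p ε L n)
      (ε ^ (p - 1) * L) (ae_of_all _ fun ω => ?_)
    rw [Real.norm_eq_abs, abs_of_nonneg (gapSum_nonneg hp1 hε hL _ _)]
    exact gapSum_le_const hp1 hε hL _ _
  have iH := integrable_rpow_runMax hy.integrable hp hp1 hε n
  have iY := hY.integrable n
  have iR := (iH.const_mul K).add ((((iD.add (iY.const_mul (ε ^ (p - 1)))).sub
    (i1.add i2)).const_mul (β ^ (p - 1) * p)))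
  have hle := integral_mono_of_nonneg (f := fun ω => |y n ω| ^ p)
    (ae_of_all _ fun ω => Real.rpow_nonneg (abs_nonneg _) _) iR (by
      filter_upwards [h0] with ω hω
      have a := abs_rpow_le_linear (x := -y n ω) hp hp1 hβ h₁ h₂
        (add_pos_of_nonneg_of_pos (hM0 n ω) hε)
        (by have := le_runMax (y := fun k => y k ω) hω n
            linarith)
      have b := mul_le_mul_of_nonneg_left
        (neg_rpow_mul_le (L := L) (y := fun k => y k ω) hp hp1 hε hω n) hβ1.le
      rw [abs_neg] at a
      simp only [Pi.add_apply, Pi.sub_apply]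
      linear_combination a + b)
  refine hle.trans ?_
  rw [integral_add' (iH.const_mul K) ((((iD.add (iY.const_mul (ε ^ (p - 1)))).sub
    (i1.add i2)).const_mul (β ^ (p - 1) * p))), integral_const_mul, integral_const_mul,
    integral_sub' (iD.add (iY.const_mul (ε ^ (p - 1)))) (i1.add i2),
    integral_add' iD (iY.const_mul (ε ^ (p - 1))), integral_add' i1 i2, integral_const_mul]
  have := mul_nonneg (mul_pos hβ1 hp).le (add_nonneg n1 n2)
  linear_combination this

theorem integral_rpow_runMax_le [IsProbabilityMeasure P] (hy : Submartingale y 𝒢 P)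
    {p : ℝ} (hp : 0 < p) (hp1 : p < 1) (n : ℕ) :
    ∫ ω, (runMax (fun k => y k ω) n + 1) ^ p ∂P ≤ (1 + p * ∫ ω, |y n ω| ∂P) / (1 - p) := by
  have hM := stronglyAdapted_runMax hy.stronglyAdapted
  have hg : StronglyAdapted 𝒢 fun n ω => (runMax (fun k => y k ω) n + 1) ^ (p - 1) := fun n =>
    (((hM n).measurable.add_const 1).pow_const (p - 1)).stronglyMeasurable
  have hg0 : ∀ n ω, 0 ≤ (runMax (fun k => y k ω) n + 1) ^ (p - 1) := fun n ω =>
    Real.rpow_nonneg (add_nonneg (runMax_nonneg _ n) zero_le_one) _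
  have hg1 : ∀ n ω, (runMax (fun k => y k ω) n + 1) ^ (p - 1) ≤ 1 := fun n ω => by
    simpa [runMax] using rpow_runMax_antitone hp1 one_pos (fun k => y k ω) (Nat.zero_le n)
  obtain ⟨i1, n1⟩ := integral_sum_mul_sub_nonneg (R := 1)
    (ξ := fun n ω => 1 - (runMax (fun k => y k ω) n + 1) ^ (p - 1)) hy
    (fun n => stronglyMeasurable_const.sub (hg n)) (fun n ω => sub_le_self _ (hg0 n ω))
    (fun n ω => sub_nonneg.2 (hg1 n ω)) n
  have iH := integrable_rpow_runMax hy.integrable hp hp1 one_pos n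
  have iA := (hy.integrable n).abs
  have hle := integral_mono (iH.const_mul (1 - p))
    (((integrable_const 1).add (iA.const_mul p)).sub (i1.const_mul p))
    (fun ω => rpow_runMax_le hp hp1 (fun k => y k ω) n)
  rw [integral_sub' ((integrable_const 1).add (iA.const_mul p)) (i1.const_mul p),
    integral_add' (integrable_const 1) (iA.const_mul p), integral_const_mul, integral_const_mul,
    integral_const_mul] at hle
  simp only [integral_const, probReal_univ, smul_eq_mul, mul_one] at hle
  rw [le_div_iff₀ (by linarith)]
  have := mul_nonneg hp.le n1
  linarith

end Discrete

theorem integrable_of_tendsto_of_integral_le {Ω : Type*} {m0 : MeasurableSpace Ω} {P : Measure Ω}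
    {f : ℕ → Ω → ℝ} {g : Ω → ℝ} {B : ℝ} (hf : ∀ n, Integrable (f n) P) (h0 : ∀ n ω, 0 ≤ f n ω)
    (hB : ∀ n, ∫ ω, f n ω ∂P ≤ B) (hlim : ∀ᵐ ω ∂P, Tendsto (fun n => f n ω) atTop (nhds (g ω))) :
    Integrable g P := by
  refine ⟨aestronglyMeasurable_of_tendsto_ae _ (fun n => (hf n).1) hlim, ?_⟩
  have h1 : ∫⁻ ω, ‖g ω‖ₑ ∂P = ∫⁻ ω, liminf (fun n => ‖f n ω‖ₑ) atTop ∂P :=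
    lintegral_congr_ae (by filter_upwards [hlim] with ω hω using hω.enorm.liminf_eq.symm)
  have h2 : ∀ n, ∫⁻ ω, ‖f n ω‖ₑ ∂P ≤ ENNReal.ofReal B := fun n => by
    rw [← ofReal_integral_norm_eq_lintegral_enorm (hf n)]
    refine ENNReal.ofReal_le_ofReal ((hB n).trans' (le_of_eq ?_))
    exact integral_congr_ae (ae_of_all _ fun ω => by simp [abs_of_nonneg (h0 n ω)])
  rw [HasFiniteIntegral, h1]
  refine (lintegral_liminf_le' fun n => (hf n).1.enorm).trans_lt ?_
  exact ((liminf_le_liminf (Eventually.of_forall h2)).trans_eq (liminf_const _)).trans_lt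
    ENNReal.ofReal_lt_top

/-- The filtration observed along the uniform grid. -/
noncomputable def gridFiltration {Ω : Type*} {m0 : MeasurableSpace Ω} (ℱ : Filtration ℝ≥0 m0)
    (t : ℝ≥0) (n : ℕ) : Filtration ℕ m0 where
  seq k := ℱ (grid t n k)
  mono' _ _ h := ℱ.mono (grid_mono t n h)
  le' _ := ℱ.le _

theorem submartingale_grid {Ω : Type*} {m0 : MeasurableSpace Ω} {P : Measure Ω}
    {ℱ : Filtration ℝ≥0 m0} {X : ℝ≥0 → Ω → ℝ} (hX : Supermartingale X ℱ P) (t : ℝ≥0) (n : ℕ) :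
    Submartingale (fun k ω => -X (grid t n k) ω) (gridFiltration ℱ t n) P :=
  ⟨fun k => hX.neg.1 (grid t n k), fun _ _ h => hX.neg.2.1 _ _ (grid_mono t n h),
    fun k => hX.neg.2.2 (grid t n k)⟩

theorem tendsto_integral_max_sub {Ω : Type*} {m0 : MeasurableSpace Ω} {P : Measure Ω}
    {f : Ω → ℝ} (hf : Integrable f P) :
    Tendsto (fun L : ℕ => ∫ ω, max (f ω - L) 0 ∂P) atTop (nhds 0) := by
  have h := tendsto_integral_of_dominated_convergence (μ := P)
    (F := fun (L : ℕ) ω => max (f ω - L) 0) (f := fun _ => 0) (fun ω => |f ω|)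
    (fun L => ((hf.1.aemeasurable.sub_const _).max aemeasurable_const).aestronglyMeasurable)
    hf.abs (fun L => ae_of_all _ fun ω => ?_) (ae_of_all _ fun ω => ?_)
  · simpa using h
  · have hL : (0 : ℝ) ≤ L := Nat.cast_nonneg L
    rw [Real.norm_eq_abs, abs_of_nonneg (le_max_right _ _)]
    exact max_le (by linarith [le_abs_self (f ω)]) (abs_nonneg _)
  · refine tendsto_const_nhds.congr' ?_
    filter_upwards [eventually_ge_atTop ⌈f ω⌉₊] with L hL
    exact (max_eq_right (by linarith [(Nat.le_ceil (f ω)).trans (Nat.cast_le.2 hL)])).symm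

/-- Sharp `L^p` bound for a supermartingale with nonnegative jumps versus its running
infimum: `E[|X_t|^p] ≤ C_p^p·E[(−M⁻_t)^p]` for `0 < p < 1`. -/
theorem supermartingale_Lp_infimum_bound
    {Ω : Type*} {m0 : MeasurableSpace Ω} {P : Measure Ω} [IsProbabilityMeasure P]
    (hcomplete : P.IsComplete)
    (ℱ : Filtration ℝ≥0 m0) (X : ℝ≥0 → Ω → ℝ)
    (hsuper : Supermartingale X ℱ P)
    (hX0 : ∀ᵐ ω ∂P, X 0 ω = 0)
    (hrc : ∀ ω, ∀ t : ℝ≥0, ContinuousWithinAt (fun s => X s ω) (Set.Ici t) t)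
    (hll : ∀ ω, ∀ t : ℝ≥0, 0 < t →
      ∃ l : ℝ, Tendsto (fun s => X s ω) (nhdsWithin t (Set.Iio t)) (nhds l))
    (hjump : ∀ ω, ∀ t : ℝ≥0, 0 < t → ∀ l : ℝ,
      Tendsto (fun s => X s ω) (nhdsWithin t (Set.Iio t)) (nhds l) → l ≤ X t ω)
    (p : ℝ) (hp : 0 < p) (hp1 : p < 1)
    (p₀ : ℝ) (hp₀ : p₀ ∈ Set.Ioo (0 : ℝ) 1)
    (hp₀eq : 1 / p₀ - 1 = (1 / p₀ - 1) ^ (1 - p₀) + 1)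
    (C : ℝ)
    (hC₁ : p ≤ p₀ → C = (1 - p) / p)
    (hC₂ : p₀ < p → ∃ α : ℝ, 0 < α ∧ (1 - p) * (α ^ (1 / (1 - p)) + 1) = α + 1 ∧
      C = (1 + α⁻¹) ^ (1 / p))
    (t : ℝ≥0) :
    ∫ ω, |X t ω| ^ p ∂P
      ≤ C ^ p * ∫ ω, (-(⨅ s : Set.Icc (0 : ℝ≥0) t, min (X s.1 ω) 0)) ^ p ∂P := by
  obtain ⟨β, hβ, h₁, h₂⟩ := exists_tangent_point hp hp1 hp₀ hp₀eq hC₁ hC₂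
  generalize C ^ p = K at h₁ h₂ ⊢
  have hK : 0 ≤ K := by
    have : 0 < β ^ (p - 1) := by positivity
    linarith
  change _ ≤ K * ∫ ω, negRunInf (fun s => X s ω) t ^ p ∂P
  set y : ℕ → ℕ → Ω → ℝ := fun n k ω => -X (grid t n k) ω with hy_def
  have hy : ∀ n, Submartingale (y n) (gridFiltration ℱ t n) P := submartingale_grid hsuper t
  have hy0 : ∀ n, ∀ᵐ ω ∂P, y n 0 ω = 0 := fun n => by
    filter_upwards [hX0] with ω hω
    simp [hy_def, grid_zero, hω]
  have hylast : ∀ n ω, y n (n + 1) ω = -X t ω := fun n ω => by simp only [hy_def, grid_last]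
  have hM : ∀ᵐ ω ∂P, (∀ n, runMax (fun k => y n k ω) (n + 1) ≤ negRunInf (fun s => X s ω) t) ∧
      Tendsto (fun n => runMax (fun k => y n k ω) (n + 1)) atTop
        (nhds (negRunInf (fun s => X s ω) t)) := by
    filter_upwards [hX0] with ω hω
    exact tendsto_runMax_negRunInf hω (hrc ω) (hll ω) (hjump ω) t
  have hM0 : ∀ᵐ ω ∂P, 0 ≤ negRunInf (fun s => X s ω) t := by
    filter_upwards [hM] with ω hω using (runMax_nonneg _ _).trans (hω.1 0)
  have hMp1 : Integrable (fun ω => (negRunInf (fun s => X s ω) t + 1) ^ p) P := by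
    refine integrable_of_tendsto_of_integral_le
      (f := fun n ω => (runMax (fun k => y n k ω) (n + 1) + 1) ^ p)
      (B := (1 + p * ∫ ω, |X t ω| ∂P) / (1 - p))
      (fun n => integrable_rpow_runMax (hy n).integrable hp hp1 one_pos (n + 1))
      (fun n ω => Real.rpow_nonneg (add_nonneg (runMax_nonneg _ _) zero_le_one) _)
      (fun n => ?_) ?_
    · have := integral_rpow_runMax_le (hy n) hp hp1 (n + 1)
      simpa only [hylast, abs_neg] using this
    · filter_upwards [hM] with ω hω
      exact (hω.2.add_const 1).rpow_const (Or.inr hp.le)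
  have hMm : AEStronglyMeasurable (fun ω => negRunInf (fun s => X s ω) t) P :=
    aestronglyMeasurable_of_tendsto_ae atTop
      (fun n => (integrable_runMax (hy n).integrable (n + 1)).1) (hM.mono fun ω hω => hω.2)
  have hMp : Integrable (fun ω => negRunInf (fun s => X s ω) t ^ p) P := by
    refine hMp1.mono' (hMm.aemeasurable.pow_const p).aestronglyMeasurable ?_
    filter_upwards [hM0] with ω hω
    rw [Real.norm_eq_abs, abs_of_nonneg (Real.rpow_nonneg hω _)]
    exact Real.rpow_le_rpow hω (by linarith) hp.le
  have hnX : Integrable (fun ω => -X t ω) P := (hsuper.integrable t).neg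
  have hD : ∀ ε L : ℝ, 0 < ε → 0 ≤ L →
      Tendsto (fun n => ∫ ω, gapSum p ε L (fun k => y n k ω) (n + 1) ∂P) atTop (nhds 0) := by
    intro ε L hε hL
    have h := tendsto_integral_of_dominated_convergence (μ := P)
      (F := fun n ω => gapSum p ε L (fun k => y n k ω) (n + 1)) (f := fun _ => 0)
      (fun _ => ε ^ (p - 1) * L)
      (fun n => aestronglyMeasurable_gapSum (hy n).stronglyAdapted p ε L (n + 1))
      (integrable_const _) (fun n => ae_of_all _ fun ω => ?_) ?_
    · simpa using h
    · rw [Real.norm_eq_abs, abs_of_nonneg (gapSum_nonneg hp1 hε hL _ _)]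
      exact gapSum_le_const hp1 hε hL _ _
    · filter_upwards [hX0] with ω hω
      exact tendsto_gapSum hω (hrc ω) (hll ω) (hjump ω) t hp1 hε hL
  have hbound : ∀ ε : ℝ, 0 < ε → ∀ L : ℕ, ∫ ω, |X t ω| ^ p ∂P ≤
      K * (∫ ω, negRunInf (fun s => X s ω) t ^ p ∂P + ε ^ p) +
      β ^ (p - 1) * p * (0 + ε ^ (p - 1) * ∫ ω, max (-X t ω - L) 0 ∂P) := by
    intro ε hε L
    refine ge_of_tendsto' (((hD ε L hε (Nat.cast_nonneg L)).add_const _).const_mul _ |>.const_add _)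
      fun n => ?_
    have h := integral_abs_rpow_le_discrete (hy n) (hy0 n) hp hp1 hβ h₁ h₂ hε
      (Nat.cast_nonneg L) (n + 1)
    simp only [hylast, abs_neg] at h
    refine h.trans (add_le_add_left (mul_le_mul_of_nonneg_left ?_ hK) _)
    have hc : ∫ ω, negRunInf (fun s => X s ω) t ^ p ∂P + ε ^ p =
        ∫ ω, (negRunInf (fun s => X s ω) t ^ p + ε ^ p) ∂P := by
      rw [integral_add hMp (integrable_const _)]; simp
    rw [hc]
    refine integral_mono_ae (integrable_rpow_runMax (hy n).integrable hp hp1 hε (n + 1))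
      (hMp.add (integrable_const _)) ?_
    filter_upwards [hM, hM0] with ω hω hω0
    have h3 := runMax_nonneg (fun k => y n k ω) (n + 1)
    exact (Real.rpow_le_rpow (by positivity) (by linarith [hω.1 n]) hp.le).trans
      (Real.rpow_add_le_add_rpow hω0 hε.le hp.le hp1.le)
  have hboundε : ∀ ε : ℝ, 0 < ε → ∫ ω, |X t ω| ^ p ∂P ≤
      K * (∫ ω, negRunInf (fun s => X s ω) t ^ p ∂P + ε ^ p) := by
    intro ε hε
    have h := ge_of_tendsto' (((((tendsto_integral_max_sub hnX).const_mul
      (ε ^ (p - 1))).const_add 0).const_mul (β ^ (p - 1) * p)).const_add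
      (K * (∫ ω, negRunInf (fun s => X s ω) t ^ p ∂P + ε ^ p))) (hbound ε hε)
    simpa using h
  have hlim : Tendsto (fun n : ℕ => ((1 : ℝ) / ((n : ℝ) + 1)) ^ p) atTop (nhds 0) := by
    have := (tendsto_one_div_add_atTop_nhds_zero_nat (𝕜 := ℝ)).rpow_const (p := p) (Or.inr hp.le)
    rwa [Real.zero_rpow hp.ne'] at this
  have h := ge_of_tendsto' ((hlim.const_add (∫ ω, negRunInf (fun s => X s ω) t ^ p ∂P)).const_mul K)
    fun n => hboundε (1 / ((n : ℝ) + 1)) Nat.one_div_pos_of_nat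
  simpa using h
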